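/- Let Γ be an infinite group generated by a finite generating family S and G = Cay(Γ, S). Then WMSF ≠ FMSF (i.e. there is an edge e ∈ E with P[e ∈ FMSF(x) \ WMSF(x)] > 0) if and only if p_c(G) < p_u(G). -/

import Mathlib

open MeasureTheory Set

noncomputable section

variable {Γ : Type} [Group Γ] {d : ℕ}

/-- The edge `(g, i)` of the Cayley graph `Cay(Γ, S)` joins `g` and `g * S i`. -/
def Joins (S : Fin d → Γ) (e : Γ × Fin d) (u v : Γ) : Prop :=
  (u = e.1 ∧ v = e.1 * S e.2) ∨ (v = e.1 ∧ u = e.1 * S e.2)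

/-- `u` and `v` are connected by a path of `ω`-open edges. -/
def OpenConn (S : Fin d → Γ) (ω : Γ × Fin d → Bool) (u v : Γ) : Prop :=
  Relation.ReflTransGen (fun a b => ∃ e, ω e = true ∧ Joins S e a b) u v

/-- The cluster of `v` in `ω`. -/
def Cluster (S : Fin d → Γ) (ω : Γ × Fin d → Bool) (v : Γ) : Set Γ :=
  {u | OpenConn S ω v u}

/-- `P` is Bernoulli(`p`) bond percolation on `Cay(Γ, S)`. -/
def IsBernoulli (S : Fin d → Γ) (p : ℝ) (P : Measure (Γ × Fin d → Bool)) : Prop :=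
  IsProbabilityMeasure P ∧
    ∀ (s : Finset (Γ × Fin d)) (f : Γ × Fin d → Bool),
      P {ω | ∀ e ∈ s, ω e = f e} = ∏ e ∈ s, ENNReal.ofReal (if f e then p else 1 - p)

/-- The event that there is an infinite cluster. -/
def PercEvent (S : Fin d → Γ) : Set (Γ × Fin d → Bool) :=
  {ω | ∃ v, (Cluster S ω v).Infinite}

/-- The critical probability `p_c(Cay(Γ, S))`. -/
def pc (S : Fin d → Γ) : ℝ :=
  sInf {p | p ∈ Icc (0:ℝ) 1 ∧
    ∀ P : Measure (Γ × Fin d → Bool), IsBernoulli S p P → P (PercEvent S) = 1}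

/-- `C` is an infinite cluster of `ω`. -/
def IsInfCluster (S : Fin d → Γ) (ω : Γ × Fin d → Bool) (C : Set Γ) : Prop :=
  (∃ v, C = Cluster S ω v) ∧ C.Infinite

/-- The event that there is exactly one infinite cluster. -/
def UniqueEvent (S : Fin d → Γ) : Set (Γ × Fin d → Bool) :=
  {ω | ∃! C : Set Γ, IsInfCluster S ω C}

/-- The uniqueness threshold `p_u(Cay(Γ, S))`. -/
def pu (S : Fin d → Γ) : ℝ :=
  sInf {p | p ∈ Icc (0:ℝ) 1 ∧
    ∀ P : Measure (Γ × Fin d → Bool), IsBernoulli S p P → P (UniqueEvent S) = 1}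

/-- `ed`, `vs` form a simple cycle of length `n` in `Cay(Γ, S)`. -/
def IsCycle (S : Fin d → Γ) (n : ℕ) (ed : Fin n → Γ × Fin d) (vs : Fin (n + 1) → Γ) : Prop :=
  0 < n ∧ vs (Fin.last n) = vs 0 ∧
    (∀ k : Fin n, Joins S (ed k) (vs k.castSucc) (vs k.succ)) ∧
    Function.Injective (fun k : Fin n => vs k.castSucc) ∧ Function.Injective ed

/-- `ed`, `vs` form a bi-infinite self-avoiding path in `Cay(Γ, S)`. -/
def IsBiInfPath (S : Fin d → Γ) (ed : ℤ → Γ × Fin d) (vs : ℤ → Γ) : Prop :=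
  Function.Injective vs ∧ ∀ n : ℤ, Joins S (ed n) (vs n) (vs (n + 1))

/-- The free minimal spanning forest of the labeling `x`: the edges `e` such that every
simple cycle containing `e` contains an edge `e' ≠ e` with `x e' > x e`. -/
def FMSF (S : Fin d → Γ) (x : Γ × Fin d → ℝ) : Set (Γ × Fin d) :=
  {e | ∀ (n : ℕ) (ed : Fin n → Γ × Fin d) (vs : Fin (n + 1) → Γ),
    IsCycle S n ed vs → (∃ k, ed k = e) → ∃ k, ed k ≠ e ∧ x e < x (ed k)}

/-- The wired minimal spanning forest of the labeling `x`: the edges `e` such that every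
extended simple cycle (a simple cycle or a bi-infinite self-avoiding path) containing `e`
contains an edge `e' ≠ e` with `x e' > x e`. -/
def WMSF (S : Fin d → Γ) (x : Γ × Fin d → ℝ) : Set (Γ × Fin d) :=
  {e | (∀ (n : ℕ) (ed : Fin n → Γ × Fin d) (vs : Fin (n + 1) → Γ),
          IsCycle S n ed vs → (∃ k, ed k = e) → ∃ k, ed k ≠ e ∧ x e < x (ed k)) ∧
       (∀ (ed : ℤ → Γ × Fin d) (vs : ℤ → Γ),
          IsBiInfPath S ed vs → (∃ k, ed k = e) → ∃ k, ed k ≠ e ∧ x e < x (ed k))}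

/-- `P` is the product `Leb^E` of uniform measures on `[0,1]^E`. -/
def IsProductLeb {E : Type} (P : Measure (E → ℝ)) : Prop :=
  IsProbabilityMeasure P ∧
    ∀ (s : Finset E) (t : E → Set ℝ), (∀ e, MeasurableSet (t e)) →
      P {x | ∀ e ∈ s, x e ∈ t e} = ∏ e ∈ s, volume (t e ∩ Icc (0:ℝ) 1)

section ProductMeasure

variable {E : Type}

/-- The uniform probability measure on `[0,1]`. -/
abbrev unif : Measure ℝ := volume.restrict (Icc (0:ℝ) 1)

instance : IsProbabilityMeasure unif := ⟨by simp⟩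

theorem unif_Ioc_ne_zero {a b : ℝ} (ha : 0 ≤ a) (hb : b ≤ 1) (hab : a < b) :
    unif (Ioc a b) ≠ 0 := by
  have hsub : Ioc a b ⊆ Icc 0 1 := fun x hx => ⟨ha.trans hx.1.le, hx.2.trans hb⟩
  rw [Measure.restrict_apply measurableSet_Ioc, inter_eq_left.2 hsub]
  simp [hab]

theorem IsProductLeb.eq_infinitePi {P : Measure (E → ℝ)} (hP : IsProductLeb P) :
    P = Measure.infinitePi (fun _ : E => unif) := by
  apply Measure.eq_infinitePi
  intro s t ht
  rw [show (Set.pi (s : Set E) t) = {x | ∀ e ∈ s, x e ∈ t e} from rfl, hP.2 s t ht]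
  exact Finset.prod_congr rfl fun e _ => (Measure.restrict_apply (ht e)).symm

theorem IsProductLeb.unique {P Q : Measure (E → ℝ)} (hP : IsProductLeb P)
    (hQ : IsProductLeb Q) : P = Q :=
  hP.eq_infinitePi.trans hQ.eq_infinitePi.symm

theorem measurableSet_box (s : Finset E) (t : E → Set ℝ) (ht : ∀ e, MeasurableSet (t e)) :
    MeasurableSet {x : E → ℝ | ∀ e ∈ s, x e ∈ t e} := by
  have : {x : E → ℝ | ∀ e ∈ s, x e ∈ t e} = ⋂ e ∈ s, (fun x : E → ℝ => x e) ⁻¹' t e := by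
    ext x; simp
  rw [this]
  exact s.measurableSet_biInter fun e _ => measurable_pi_apply e (ht e)

variable [DecidableEq E]

theorem measurable_update_pair (e : E) :
    Measurable (fun q : ℝ × (E → ℝ) => Function.update q.2 e q.1) := by
  rw [measurable_pi_iff]
  intro a
  by_cases h : a = e
  · subst h; simpa using measurable_fst
  · simp only [Function.update_of_ne h]
    exact (measurable_pi_apply a).comp measurable_snd

/-- Resampling the label of one edge preserves the product measure. -/
theorem IsProductLeb.measurePreserving_update {P : Measure (E → ℝ)} (hP : IsProductLeb P)
    (e : E) :
    MeasurePreserving (fun q : ℝ × (E → ℝ) => Function.update q.2 e q.1) (unif.prod P) P := by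
  have := hP.1
  refine ⟨measurable_update_pair e, IsProductLeb.unique ⟨?_, ?_⟩ hP⟩
  · exact Measure.isProbabilityMeasure_map (measurable_update_pair e).aemeasurable
  intro s t ht
  rw [Measure.map_apply (measurable_update_pair e) (measurableSet_box s t ht)]
  by_cases hes : e ∈ s
  · have : (fun q : ℝ × (E → ℝ) => Function.update q.2 e q.1) ⁻¹' {x | ∀ e ∈ s, x e ∈ t e}
        = t e ×ˢ {x | ∀ a ∈ s.erase e, x a ∈ t a} := by
      ext ⟨r, x⟩
      simp only [mem_preimage, mem_ofPred_eq, mem_prod, Finset.mem_erase]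
      constructor
      · intro h
        refine ⟨by simpa using h e hes, fun a ha => ?_⟩
        simpa [Function.update_of_ne ha.1] using h a ha.2
      · rintro ⟨h1, h2⟩ a ha
        by_cases hae : a = e
        · subst hae; simpa using h1
        · simpa [Function.update_of_ne hae] using h2 a ⟨hae, ha⟩
    rw [this, Measure.prod_prod, hP.2 _ t ht, Measure.restrict_apply (ht e),
      Finset.mul_prod_erase s (fun a => volume (t a ∩ Icc (0:ℝ) 1)) hes]
  · have : (fun q : ℝ × (E → ℝ) => Function.update q.2 e q.1) ⁻¹' {x | ∀ e ∈ s, x e ∈ t e}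
        = univ ×ˢ {x | ∀ a ∈ s, x a ∈ t a} := by
      ext ⟨r, x⟩
      simp only [mem_preimage, mem_ofPred_eq, mem_prod, mem_univ, true_and]
      refine forall₂_congr fun a ha => ?_
      rw [Function.update_of_ne (ne_of_mem_of_not_mem ha hes)]
    rw [this, Measure.prod_prod, hP.2 _ t ht, measure_univ, one_mul]

/-- If resampling the label of `e` inside a set of positive measure turns `C` into `B` and `B`
is null, then `C` is null. -/
theorem IsProductLeb.null_of_update {P : Measure (E → ℝ)} (hP : IsProductLeb P) (e : E)
    {J : Set ℝ} (hJ : unif J ≠ 0) {B C : Set (E → ℝ)} (hB : P B = 0)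
    (h : ∀ x ∈ C, ∀ r ∈ J, Function.update x e r ∈ B) : P C = 0 := by
  have := hP.1
  have h0 := (hP.measurePreserving_update e).quasiMeasurePreserving.preimage_null hB
  have h1 : unif J * P C = 0 := by
    rw [← Measure.prod_prod]
    exact measure_mono_null (fun q hq => h q.2 hq.2 q.1 hq.1) h0
  exact (mul_eq_zero.1 h1).resolve_left hJ

/-- Kolmogorov's zero-one law, for events insensitive to the label of any single edge. -/
theorem IsProductLeb.zero_one {P : Measure (E → ℝ)} (hP : IsProductLeb P)
    {A : Set (E → ℝ)} (hA : MeasurableSet A)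
    (hinv : ∀ x e r, Function.update x e r ∈ A ↔ x ∈ A) (h0 : P A ≠ 0) : P A = 1 := by
  have := hP.1
  have key : ∀ (s : Finset E) (t : E → Set ℝ), (∀ e, MeasurableSet (t e)) →
      P (A ∩ {x | ∀ e ∈ s, x e ∈ t e}) = P A * ∏ e ∈ s, volume (t e ∩ Icc (0:ℝ) 1) := by
    intro s t ht
    induction s using Finset.induction_on with
    | empty => simp
    | insert e s hes ih =>
      have hm := hA.inter (measurableSet_box (insert e s) t ht)
      rw [← (hP.measurePreserving_update e).measure_preimage hm.nullMeasurableSet]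
      have : (fun q : ℝ × (E → ℝ) => Function.update q.2 e q.1) ⁻¹'
          (A ∩ {x | ∀ a ∈ insert e s, x a ∈ t a})
          = t e ×ˢ (A ∩ {x | ∀ a ∈ s, x a ∈ t a}) := by
        ext ⟨r, x⟩
        simp only [mem_preimage, mem_inter_iff, hinv, mem_ofPred_eq, mem_prod,
          Finset.mem_insert, forall_eq_or_imp, Function.update_self]
        have : (∀ a ∈ s, Function.update x e r a ∈ t a) ↔ ∀ a ∈ s, x a ∈ t a :=
          forall₂_congr fun a ha => by rw [Function.update_of_ne (ne_of_mem_of_not_mem ha hes)]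
        rw [this]; tauto
      rw [this, Measure.prod_prod, ih, Finset.prod_insert hes, Measure.restrict_apply (ht e)]
      ring
  have hQ : IsProductLeb (ProbabilityTheory.cond P A) := by
    refine ⟨ProbabilityTheory.cond_isProbabilityMeasure h0, fun s t ht => ?_⟩
    rw [ProbabilityTheory.cond_apply hA, key s t ht, ← mul_assoc,
      ENNReal.inv_mul_cancel h0 (measure_ne_top P A), one_mul]
  rw [← hQ.unique hP]
  exact ProbabilityTheory.cond_apply_self h0 (measure_ne_top P A)

end ProductMeasure

section Clusters

theorem Joins.symm {S : Fin d → Γ} {e : Γ × Fin d} {u v : Γ} (h : Joins S e u v) :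
    Joins S e v u := Or.symm h

theorem Joins.eq_or_eq {S : Fin d → Γ} {e : Γ × Fin d} {a b a' b' : Γ} (h : Joins S e a b)
    (h' : Joins S e a' b') : a = a' ∧ b = b' ∨ a = b' ∧ b = a' := by
  rcases h with ⟨rfl, rfl⟩ | ⟨rfl, rfl⟩ <;> rcases h' with ⟨rfl, rfl⟩ | ⟨rfl, rfl⟩ <;> simp

variable {S : Fin d → Γ} {ω ω' : Γ × Fin d → Bool} {u v w : Γ} {e : Γ × Fin d}

theorem OpenConn.refl (S : Fin d → Γ) (ω : Γ × Fin d → Bool) (u : Γ) : OpenConn S ω u u :=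
  Relation.ReflTransGen.refl

theorem OpenConn.trans (h : OpenConn S ω u v) (h' : OpenConn S ω v w) : OpenConn S ω u w :=
  Relation.ReflTransGen.trans h h'

theorem OpenConn.symm (h : OpenConn S ω u v) : OpenConn S ω v u := by
  induction h with
  | refl => exact Relation.ReflTransGen.refl
  | tail _ hstep ih =>
    obtain ⟨e, he, hj⟩ := hstep
    exact Relation.ReflTransGen.head ⟨e, he, hj.symm⟩ ih

theorem Joins.openConn (h : Joins S e u v) (he : ω e = true) : OpenConn S ω u v :=
  Relation.ReflTransGen.single ⟨e, he, h⟩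

theorem OpenConn.mono (hω : ∀ e, ω e = true → ω' e = true) (h : OpenConn S ω u v) :
    OpenConn S ω' u v := by
  induction h with
  | refl => exact OpenConn.refl S ω' u
  | tail _ hstep ih =>
    obtain ⟨e, he, hj⟩ := hstep
    exact ih.tail ⟨e, hω e he, hj⟩

theorem cluster_mono (hω : ∀ e, ω e = true → ω' e = true) (u : Γ) :
    Cluster S ω u ⊆ Cluster S ω' u := fun _ h => OpenConn.mono hω h

theorem OpenConn.cluster_eq (h : OpenConn S ω u v) : Cluster S ω u = Cluster S ω v :=
  Set.ext fun _ => ⟨fun h' => h.symm.trans h', fun h' => h.trans h'⟩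

theorem mem_cluster_self (S : Fin d → Γ) (ω : Γ × Fin d → Bool) (u : Γ) : u ∈ Cluster S ω u :=
  OpenConn.refl S ω u

open scoped Classical in
/-- Changing the state of an edge not touching a cluster does not change this cluster. -/
theorem cluster_update (hj : Joins S e v w) (hv : v ∉ Cluster S ω u) (hw : w ∉ Cluster S ω u)
    (b : Bool) : Cluster S (Function.update ω e b) u = Cluster S ω u := by
  have key : ∀ z z', OpenConn S ω u z → ¬ Joins S e z z' := by
    intro z z' hz hj'
    rcases hj.eq_or_eq hj' with ⟨rfl, -⟩ | ⟨-, rfl⟩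
    exacts [hv hz, hw hz]
  ext z
  constructor
  · intro h
    induction h with
    | refl => exact mem_cluster_self S ω u
    | tail _ hstep ih =>
      obtain ⟨f, hf, hjf⟩ := hstep
      have hne : f ≠ e := fun h => key _ _ ih (h ▸ hjf)
      rw [Function.update_of_ne hne] at hf
      exact OpenConn.trans ih (hjf.openConn hf)
  · intro h
    induction h with
    | refl => exact mem_cluster_self S _ u
    | tail hz hstep ih =>
      obtain ⟨f, hf, hjf⟩ := hstep
      have hne : f ≠ e := fun h => key _ _ hz (h ▸ hjf)
      exact OpenConn.trans ih (hjf.openConn (by rwa [Function.update_of_ne hne]))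

theorem exists_finset_openConn (h : OpenConn S ω u v) :
    ∃ F : Finset (Γ × Fin d), (∀ e ∈ F, ω e = true) ∧
      ∀ ω' : Γ × Fin d → Bool, (∀ e ∈ F, ω' e = true) → OpenConn S ω' u v := by
  classical
  induction h with
  | refl => exact ⟨∅, by simp, fun ω' _ => OpenConn.refl S ω' u⟩
  | tail _ hstep ih =>
    obtain ⟨F, hF, hF'⟩ := ih
    obtain ⟨f, hf, hjf⟩ := hstep
    refine ⟨insert f F, by simpa [hf] using hF, fun ω' h => ?_⟩
    exact (hF' ω' fun e he => h e (Finset.mem_insert_of_mem he)).trans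
      (hjf.openConn (h f (Finset.mem_insert_self f F)))

theorem openConn_top (hgen : Subgroup.closure (Set.range S) = ⊤) (u v : Γ)
    (hω : ∀ e, ω e = true) : OpenConn S ω u v := by
  have key : ∀ g ∈ Subgroup.closure (Set.range S), ∀ u, OpenConn S ω u (u * g) := by
    intro g hg
    induction hg using Subgroup.closure_induction with
    | mem g hg =>
      obtain ⟨i, rfl⟩ := hg
      exact fun u => Joins.openConn (e := (u, i)) (Or.inl ⟨rfl, rfl⟩) (hω _)
    | one => exact fun u => by simpa using OpenConn.refl S ω u
    | mul g h _ _ hg hh => exact fun u => (hg u).trans (by simpa [mul_assoc] using hh (u * g))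
    | inv g _ hg => exact fun u => by simpa using (hg (u * g⁻¹)).symm
  simpa using key (u⁻¹ * v) (by simp [hgen]) u

theorem countable_of_closure_eq_top (hgen : Subgroup.closure (Set.range S) = ⊤) :
    Countable Γ := by
  have hs : Function.Surjective (FreeGroup.lift S) := by
    rw [← MonoidHom.range_eq_top, FreeGroup.range_lift_eq_closure, hgen]
  have : Countable (FreeGroup (Fin d)) :=
    (Quot.mk_surjective (r := FreeGroup.Red.Step (α := Fin d))).countable
  exact hs.countable

theorem mem_uniqueEvent_iff : ω ∈ UniqueEvent S ↔ ω ∈ PercEvent S ∧ ∀ u v,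
    (Cluster S ω u).Infinite → (Cluster S ω v).Infinite → OpenConn S ω u v := by
  constructor
  · rintro ⟨C, ⟨⟨v, rfl⟩, hinf⟩, huniq⟩
    refine ⟨⟨v, hinf⟩, fun a b ha hb => ?_⟩
    have h : Cluster S ω a = Cluster S ω b :=
      (huniq _ ⟨⟨a, rfl⟩, ha⟩).trans (huniq _ ⟨⟨b, rfl⟩, hb⟩).symm
    have : b ∈ Cluster S ω a := h ▸ mem_cluster_self S ω b
    exact this
  · rintro ⟨⟨v, hv⟩, h⟩
    refine ⟨_, ⟨⟨v, rfl⟩, hv⟩, ?_⟩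
    rintro C ⟨⟨w, rfl⟩, hw⟩
    exact (h w v hw hv).cluster_eq

variable [Countable Γ]

theorem measurableSet_openConn (S : Fin d → Γ) (u v : Γ) :
    MeasurableSet {ω : Γ × Fin d → Bool | OpenConn S ω u v} := by
  classical
  have : {ω : Γ × Fin d → Bool | OpenConn S ω u v} =
      ⋃ F : Finset (Γ × Fin d), ⋃ _ : ∀ ω' : Γ × Fin d → Bool, (∀ e ∈ F, ω' e = true) →
        OpenConn S ω' u v, ⋂ e ∈ F, (fun ω : Γ × Fin d → Bool => ω e) ⁻¹' {true} := by
    ext ω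
    simp only [mem_ofPred_eq, mem_iUnion, mem_iInter, mem_preimage, mem_singleton_iff,
      exists_prop]
    constructor
    · intro h
      obtain ⟨F, h1, h2⟩ := exists_finset_openConn h
      exact ⟨F, h2, h1⟩
    · rintro ⟨F, h1, h2⟩
      exact h1 ω h2
  rw [this]
  refine MeasurableSet.iUnion fun F => MeasurableSet.iUnion fun _ => ?_
  exact F.measurableSet_biInter fun e _ => measurable_pi_apply e (measurableSet_singleton _)

theorem measurableSet_cluster_infinite (S : Fin d → Γ) (v : Γ) :
    MeasurableSet {ω : Γ × Fin d → Bool | (Cluster S ω v).Infinite} := by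
  have : {ω : Γ × Fin d → Bool | (Cluster S ω v).Infinite} =
      ⋂ F : Finset Γ, ⋃ u : Γ, ⋃ _ : u ∉ F, {ω | OpenConn S ω v u} := by
    ext ω
    simp only [mem_ofPred_eq, mem_iUnion, mem_iInter, exists_prop]
    constructor
    · intro h F
      obtain ⟨u, hu, hF⟩ := h.exists_notMem_finset F
      exact ⟨u, hF, hu⟩
    · intro h hfin
      obtain ⟨u, hu, hc⟩ := h hfin.toFinset
      exact hu (hfin.mem_toFinset.2 hc)
  rw [this]
  exact MeasurableSet.iInter fun F => MeasurableSet.iUnion fun u => MeasurableSet.iUnion fun _ =>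
    measurableSet_openConn S v u

theorem measurableSet_percEvent (S : Fin d → Γ) : MeasurableSet (PercEvent S) := by
  have : PercEvent S = ⋃ v, {ω | (Cluster S ω v).Infinite} := by
    ext; simp [PercEvent]
  rw [this]
  exact MeasurableSet.iUnion fun v => measurableSet_cluster_infinite S v

theorem measurableSet_uniqueEvent (S : Fin d → Γ) : MeasurableSet (UniqueEvent S) := by
  have : UniqueEvent S = PercEvent S ∩ ⋂ u, ⋂ v, ({ω | (Cluster S ω u).Infinite}ᶜ ∪
      ({ω | (Cluster S ω v).Infinite}ᶜ ∪ {ω | OpenConn S ω u v})) := by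
    ext ω
    rw [mem_uniqueEvent_iff]
    simp only [mem_inter_iff, mem_iInter, mem_union, mem_compl_iff, mem_ofPred_eq,
      imp_iff_not_or]
  rw [this]
  exact (measurableSet_percEvent S).inter <| MeasurableSet.iInter fun u =>
    MeasurableSet.iInter fun v => (measurableSet_cluster_infinite S u).compl.union <|
      (measurableSet_cluster_infinite S v).compl.union (measurableSet_openConn S u v)

end Clusters

section Levels

/-- The percolation configuration of the edges with label at most `t`. -/
def level {E : Type} (t : ℝ) (x : E → ℝ) : E → Bool := fun e => decide (x e ≤ t)

theorem level_eq_true {E : Type} {t : ℝ} {x : E → ℝ} {e : E} : level t x e = true ↔ x e ≤ t := by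
  simp [level]

theorem level_mono {E : Type} {s t : ℝ} (hst : s ≤ t) (x : E → ℝ) (e : E)
    (h : level s x e = true) : level t x e = true :=
  level_eq_true.2 ((level_eq_true.1 h).trans hst)

theorem level_update {E : Type} [DecidableEq E] (t : ℝ) (x : E → ℝ) (e : E) (r : ℝ) :
    level t (Function.update x e r) = Function.update (level t x) e (decide (r ≤ t)) := by
  ext a
  by_cases h : a = e
  · subst h; simp [level]
  · simp [level, h]

theorem measurable_level_pair (E : Type) :
    Measurable (fun q : ℝ × (E → ℝ) => level q.1 q.2) := by
  rw [measurable_pi_iff]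
  intro e
  apply measurable_to_bool
  have : (fun q : ℝ × (E → ℝ) => level q.1 q.2 e) ⁻¹' {true} = {q | q.2 e ≤ q.1} := by
    ext q; simp [level]
  rw [this]
  exact measurableSet_le ((measurable_pi_apply e).comp measurable_snd) measurable_fst

theorem measurable_level {E : Type} (t : ℝ) : Measurable (level t : (E → ℝ) → E → Bool) :=
  (measurable_level_pair E).comp measurable_prodMk_left

theorem IsBernoulli.unique {S : Fin d → Γ} {p : ℝ} {P Q : Measure (Γ × Fin d → Bool)}
    (hP : IsBernoulli S p P) (hQ : IsBernoulli S p Q) : P = Q := by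
  have := hP.1
  have := hQ.1
  refine ext_of_generate_finite {A | ∃ (s : Finset (Γ × Fin d)) (f : Γ × Fin d → Bool),
    A = {ω | ∀ e ∈ s, ω e = f e}} ?_ ?_ ?_ (by simp)
  · apply le_antisymm
    · suffices h : @Measurable _ _ (MeasurableSpace.generateFrom _) _
          (id : (Γ × Fin d → Bool) → Γ × Fin d → Bool) from fun A hA => h hA
      refine @measurable_pi_lambda _ _ _ (MeasurableSpace.generateFrom _) _ _ fun e => ?_
      apply @measurable_to_bool _ (MeasurableSpace.generateFrom _)
      refine MeasurableSpace.measurableSet_generateFrom ⟨{e}, fun _ => true, ?_⟩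
      ext; simp
    · refine MeasurableSpace.generateFrom_le ?_
      rintro _ ⟨s, f, rfl⟩
      have : {ω : Γ × Fin d → Bool | ∀ e ∈ s, ω e = f e} =
          ⋂ e ∈ s, (fun ω : Γ × Fin d → Bool => ω e) ⁻¹' {f e} := by ext; simp
      rw [this]
      exact s.measurableSet_biInter fun e _ => measurable_pi_apply e (measurableSet_singleton _)
  · classical
    rintro _ ⟨s, f, rfl⟩ _ ⟨s', f', rfl⟩ ⟨ω₀, h₀, h₀'⟩
    refine ⟨s ∪ s', ω₀, ?_⟩
    ext ω
    simp only [mem_inter_iff, mem_ofPred_eq, Finset.mem_union] at *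
    constructor
    · rintro ⟨h, h'⟩ e (he | he)
      · rw [h e he, h₀ e he]
      · rw [h' e he, h₀' e he]
    · intro h
      exact ⟨fun e he => by rw [h e (.inl he), h₀ e he], fun e he => by rw [h e (.inr he), h₀' e he]⟩
  · rintro _ ⟨s, f, rfl⟩
    rw [hP.2, hQ.2]

theorem IsProductLeb.isBernoulli_map_level (S : Fin d → Γ) {P : Measure (Γ × Fin d → ℝ)}
    (hP : IsProductLeb P) {p : ℝ} (hp : p ∈ Icc (0:ℝ) 1) :
    IsBernoulli S p (P.map (level p)) := by
  have := hP.1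
  refine ⟨Measure.isProbabilityMeasure_map (measurable_level p).aemeasurable, fun s f => ?_⟩
  have hm : MeasurableSet {ω : Γ × Fin d → Bool | ∀ e ∈ s, ω e = f e} := by
    have : {ω : Γ × Fin d → Bool | ∀ e ∈ s, ω e = f e} =
        ⋂ e ∈ s, (fun ω : Γ × Fin d → Bool => ω e) ⁻¹' {f e} := by ext; simp
    rw [this]
    exact s.measurableSet_biInter fun e _ => measurable_pi_apply e (measurableSet_singleton _)
  rw [Measure.map_apply (measurable_level p) hm]
  have : level p ⁻¹' {ω : Γ × Fin d → Bool | ∀ e ∈ s, ω e = f e} =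
      {x | ∀ e ∈ s, x e ∈ (if f e then Iic p else Ioi p)} := by
    ext x
    simp only [mem_preimage, mem_ofPred_eq]
    refine forall₂_congr fun e _ => ?_
    cases h : f e <;> simp [level]
  rw [this, hP.2 s _ (fun e => by split_ifs; exacts [measurableSet_Iic, measurableSet_Ioi])]
  refine Finset.prod_congr rfl fun e _ => ?_
  cases f e
  · have : Ioi p ∩ Icc 0 1 = Ioc p 1 := by
      ext y; simp only [mem_inter_iff, mem_Ioi, mem_Icc, mem_Ioc]
      exact ⟨fun h => ⟨h.1, h.2.2⟩, fun h => ⟨h.1, hp.1.trans h.1.le, h.2⟩⟩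
    simp [this]
  · have : Iic p ∩ Icc 0 1 = Icc 0 p := by
      ext y; simp only [mem_inter_iff, mem_Iic, mem_Icc]
      exact ⟨fun h => ⟨h.2.1, h.1⟩, fun h => ⟨h.2, h.1, h.2.trans hp.2⟩⟩
    simp [this]

theorem forall_isBernoulli_iff {S : Fin d → Γ} {P : Measure (Γ × Fin d → ℝ)}
    (hP : IsProductLeb P) {p : ℝ} (hp : p ∈ Icc (0:ℝ) 1) {A : Set (Γ × Fin d → Bool)}
    (hA : MeasurableSet A) :
    (∀ Q : Measure (Γ × Fin d → Bool), IsBernoulli S p Q → Q A = 1) ↔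
      ∀ᵐ x ∂P, level p x ∈ A := by
  have := hP.1
  have hB := hP.isBernoulli_map_level S hp
  have h1 : (∀ᵐ x ∂P, level p x ∈ A) ↔ P.map (level p) A = 1 := by
    rw [Measure.map_apply (measurable_level p) hA, ← mem_ae_iff_prob_eq_one (measurable_level p hA)]
    rfl
  rw [h1]
  exact ⟨fun h => h _ hB, fun h Q hQ => hQ.unique hB ▸ h⟩

end Levels

section MassTransport

/-- Left translation of edges. -/
def shiftEdge (g : Γ) (e : Γ × Fin d) : Γ × Fin d := (g * e.1, e.2)

theorem shiftEdge_inv_shiftEdge (g : Γ) (e : Γ × Fin d) :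
    shiftEdge g⁻¹ (shiftEdge g e) = e := by simp [shiftEdge]

theorem shiftEdge_shiftEdge_inv (g : Γ) (e : Γ × Fin d) :
    shiftEdge g (shiftEdge g⁻¹ e) = e := by simp [shiftEdge]

theorem shiftEdge_injective (g : Γ) : Function.Injective (shiftEdge g : Γ × Fin d → Γ × Fin d) :=
  Function.LeftInverse.injective (shiftEdge_inv_shiftEdge g)

theorem joins_shiftEdge {S : Fin d → Γ} (g : Γ) {e : Γ × Fin d} {u v : Γ} :
    Joins S (shiftEdge g e) (g * u) (g * v) ↔ Joins S e u v := by
  simp [Joins, shiftEdge, mul_assoc]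

theorem OpenConn.of_shift {S : Fin d → Γ} {ω : Γ × Fin d → Bool} (g : Γ) {u v : Γ}
    (h : OpenConn S (ω ∘ shiftEdge g) u v) : OpenConn S ω (g * u) (g * v) := by
  induction h with
  | refl => exact OpenConn.refl S ω _
  | tail _ hstep ih =>
    obtain ⟨e, he, hj⟩ := hstep
    exact ih.trans (((joins_shiftEdge g).2 hj).openConn he)

theorem openConn_shift {S : Fin d → Γ} {ω : Γ × Fin d → Bool} (g : Γ) {u v : Γ} :
    OpenConn S (ω ∘ shiftEdge g) u v ↔ OpenConn S ω (g * u) (g * v) := by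
  refine ⟨OpenConn.of_shift g, fun h => ?_⟩
  have hω : ω = (ω ∘ shiftEdge g) ∘ shiftEdge g⁻¹ := by
    ext e; simp [shiftEdge_shiftEdge_inv]
  rw [hω] at h
  simpa using OpenConn.of_shift g⁻¹ h

theorem cluster_shift_infinite {S : Fin d → Γ} {ω : Γ × Fin d → Bool} (g : Γ) {u : Γ} :
    (Cluster S (ω ∘ shiftEdge g) u).Infinite ↔ (Cluster S ω (g * u)).Infinite := by
  have : Cluster S ω (g * u) = (fun v => g * v) '' Cluster S (ω ∘ shiftEdge g) u := by
    ext v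
    constructor
    · intro h
      refine ⟨g⁻¹ * v, (openConn_shift g).2 ?_, by simp⟩
      rwa [mul_inv_cancel_left]
    · rintro ⟨v, h, rfl⟩
      exact (openConn_shift g).1 h
  rw [this, Set.infinite_image_iff (mul_right_injective g).injOn]

theorem IsProductLeb.measurePreserving_shift {P : Measure (Γ × Fin d → ℝ)}
    (hP : IsProductLeb P) (g : Γ) :
    MeasurePreserving (fun x : Γ × Fin d → ℝ => x ∘ shiftEdge g) P P := by
  have := hP.1
  have hm : Measurable (fun x : Γ × Fin d → ℝ => x ∘ shiftEdge g) :=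
    measurable_pi_iff.2 fun e => measurable_pi_apply _
  refine ⟨hm, IsProductLeb.unique ⟨Measure.isProbabilityMeasure_map hm.aemeasurable, ?_⟩ hP⟩
  intro s t ht
  rw [Measure.map_apply hm (measurableSet_box s t ht)]
  have : (fun x : Γ × Fin d → ℝ => x ∘ shiftEdge g) ⁻¹' {x | ∀ e ∈ s, x e ∈ t e} =
      {x | ∀ e ∈ s.map ⟨shiftEdge g, shiftEdge_injective g⟩, x e ∈ t (shiftEdge g⁻¹ e)} := by
    ext x
    simp only [mem_preimage, mem_ofPred_eq, Finset.forall_mem_map, Function.Embedding.coeFn_mk,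
      shiftEdge_inv_shiftEdge, Function.comp_apply]
  rw [this, hP.2 _ _ (fun e => ht _)]
  simp [shiftEdge_inv_shiftEdge]

/-- Mass transport: if every vertex sends mass to at most one vertex, in an equivariant way,
then almost surely every vertex receives mass from finitely many vertices only. -/
theorem IsProductLeb.ae_finite_receive [Countable Γ] {P : Measure (Γ × Fin d → ℝ)}
    (hP : IsProductLeb P) (A : Γ → Γ → Set (Γ × Fin d → ℝ)) (hA : ∀ y b, MeasurableSet (A y b))
    (hshift : ∀ g y b x, x ∘ shiftEdge g ∈ A y b ↔ x ∈ A (g * y) (g * b))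
    (huniq : ∀ x y b b', x ∈ A y b → x ∈ A y b' → b = b') :
    ∀ᵐ x ∂P, ∀ b, {y | x ∈ A y b}.Finite := by
  have := hP.1
  rw [ae_all_iff]
  intro b
  apply ae_finite_setOfPred_mem
  have h1 : ∀ y, P (A y b) = P (A 1 (y⁻¹ * b)) := by
    intro y
    rw [← (hP.measurePreserving_shift y).measure_preimage (hA 1 (y⁻¹ * b)).nullMeasurableSet]
    congr 1
    ext x
    have := hshift y 1 (y⁻¹ * b) x
    rw [mul_one, mul_inv_cancel_left] at this
    exact this.symm
  simp_rw [h1]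
  have h2 := Equiv.tsum_eq ((Equiv.inv Γ).trans (Equiv.mulRight b)) (fun c => P (A 1 c))
  simp only [Equiv.trans_apply, Equiv.inv_apply, Equiv.coe_mulRight] at h2
  rw [h2, ← measure_iUnion _ (fun c => hA 1 c)]
  · exact measure_ne_top P _
  · intro c c' hcc
    exact Set.disjoint_left.2 fun x hx hx' => hcc (huniq x 1 c c' hx hx')

open scoped Classical in
/-- The vertex `y` is attached in `β` to the infinite `α`-clusters through a single edge, whose
endpoint in an infinite `α`-cluster is `b`. -/
def Attached (S : Fin d → Γ) (α β : Γ × Fin d → Bool) (y b : Γ) : Prop :=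
  (Cluster S α b).Infinite ∧ ∃ e a, β e = true ∧ Joins S e a b ∧
    OpenConn S (Function.update β e false) y a ∧
    ∀ z, (Cluster S α z).Infinite → ¬ OpenConn S (Function.update β e false) y z

theorem Attached.unique {S : Fin d → Γ} {α β : Γ × Fin d → Bool} {y b b' : Γ}
    (h : Attached S α β y b) (h' : Attached S α β y b') : b = b' := by
  classical
  obtain ⟨hb, e, a, he, hj, hya, hn⟩ := h
  obtain ⟨hb', e', a', he', hj', hya', hn'⟩ := h'
  by_cases hee : e = e'
  · subst hee
    rcases hj.eq_or_eq hj' with ⟨-, h⟩ | ⟨-, rfl⟩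
    · exact h
    · exact absurd (by convert hya') (hn _ hb)
  · exfalso
    have key : ∀ z, OpenConn S (Function.update β e false) y z →
        OpenConn S (Function.update β e' false) y z := by
      intro z hz
      induction hz with
      | refl => exact OpenConn.refl S _ y
      | tail hz hstep ih =>
        obtain ⟨f, hf, hjf⟩ := hstep
        have hfb : β f = true := by
          by_cases hfe : f = e
          · subst hfe; simp at hf
          · rwa [Function.update_of_ne hfe] at hf
        by_cases hfe' : f = e'
        · subst hfe'
          exfalso
          rcases hj'.eq_or_eq hjf with ⟨-, rfl⟩ | ⟨-, rfl⟩
          · exact hn _ hb' (by convert OpenConn.trans hz (hjf.openConn hf))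
          · exact hn _ hb' (by convert show OpenConn S _ y _ from hz)
        · exact ih.trans (hjf.openConn (by rwa [Function.update_of_ne hfe']))
    refine hn' b hb ?_
    have := (key a (by convert hya)).trans
      (hj.openConn (by rwa [Function.update_of_ne hee]))
    convert this

theorem attached_shift {S : Fin d → Γ} {α β : Γ × Fin d → Bool} (g : Γ) {y b : Γ} :
    Attached S (α ∘ shiftEdge g) (β ∘ shiftEdge g) y b ↔ Attached S α β (g * y) (g * b) := by
  classical
  have hupd : ∀ e, Function.update (β ∘ shiftEdge g) e false =
      Function.update β (shiftEdge g e) false ∘ shiftEdge g := fun e =>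
    (Function.update_comp_eq_of_injective β (shiftEdge_injective g) e false).symm
  simp only [Attached, cluster_shift_infinite]
  refine and_congr_right fun _ => ?_
  constructor
  · rintro ⟨e, a, he, hj, hya, hn⟩
    refine ⟨shiftEdge g e, g * a, he, (joins_shiftEdge g).2 hj, ?_, fun z hz => ?_⟩
    · rw [← openConn_shift]; convert hya; exact (hupd e).symm
    · have := hn (g⁻¹ * z) (by simpa using hz)
      contrapose! this
      have h2 : OpenConn S (Function.update β (shiftEdge g e) false) (g * y) (g * (g⁻¹ * z)) := by
        rw [mul_inv_cancel_left]; convert this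
      rw [← openConn_shift, ← hupd] at h2
      convert h2
  · rintro ⟨e, a, he, hj, hya, hn⟩
    have hee := shiftEdge_shiftEdge_inv g e
    refine ⟨shiftEdge g⁻¹ e, g⁻¹ * a, by simpa [hee] using he, ?_, ?_, fun z hz h => ?_⟩
    · rw [← joins_shiftEdge g, hee]; simpa using hj
    · have h2 : OpenConn S (Function.update β e false) (g * y) (g * (g⁻¹ * a)) := by
        rw [mul_inv_cancel_left]; convert hya
      rw [← hee, ← openConn_shift, ← hupd] at h2
      convert h2
    · refine hn _ hz ?_
      have h2 : OpenConn S (Function.update (β ∘ shiftEdge g) (shiftEdge g⁻¹ e) false) y z := by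
        convert h
      rw [hupd, openConn_shift, hee] at h2
      convert h2

theorem measurableSet_attached [Countable Γ] (S : Fin d → Γ) (q t : ℝ) (y b : Γ) :
    MeasurableSet {x : Γ × Fin d → ℝ | Attached S (level q x) (level t x) y b} := by
  classical
  have hinf : ∀ v, Measurable fun x : Γ × Fin d → ℝ => (Cluster S (level q x) v).Infinite :=
    fun v => (measurable_level q (measurableSet_cluster_infinite S v)).mem
  have hconn : ∀ e u v, Measurable fun x : Γ × Fin d → ℝ =>
      OpenConn S (Function.update (level t x) e false) u v := fun e u v =>
    ((measurable_update_left.comp (measurable_level t)) (measurableSet_openConn S u v)).mem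
  have hopen : ∀ e, Measurable fun x : Γ × Fin d → ℝ => level t x e = true := fun e =>
    (((measurable_pi_apply e).comp (measurable_level t)) (measurableSet_singleton true)).mem
  refine Measurable.setOf ((hinf b).and (Measurable.exists fun e => Measurable.exists fun a =>
    (hopen e).and (measurable_const.and (Measurable.and ?_ (Measurable.forall fun z =>
      (hinf z).imp (Measurable.not ?_))))))
  · convert hconn e y a
  · convert hconn e y z

end MassTransport

section Monotonicity

variable {S : Fin d → Γ} {P : Measure (Γ × Fin d → ℝ)}

/-- The cluster of `u` in `β` is infinite and meets no infinite cluster of `α`. -/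
def Detached (S : Fin d → Γ) (α β : Γ × Fin d → Bool) (u : Γ) : Prop :=
  (Cluster S β u).Infinite ∧ ∀ z, (Cluster S α z).Infinite → ¬ OpenConn S β u z

theorem Detached.congr {α β : Γ × Fin d → Bool} {u v : Γ} (h : Detached S α β u)
    (huv : OpenConn S β u v) : Detached S α β v :=
  ⟨huv.cluster_eq ▸ h.1, fun z hz hvz => h.2 z hz (huv.trans hvz)⟩

open scoped Classical in
/-- Opening in `β` an edge between a detached cluster and an infinite `α`-cluster. -/
theorem Detached.attached_update {α β : Γ × Fin d → Bool} (hαβ : ∀ e, α e = true → β e = true)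
    {u v y : Γ} {e : Γ × Fin d} (hj : Joins S e u v) (hu : Detached S α β u)
    (hv : (Cluster S α v).Infinite) (hy : OpenConn S β u y) :
    Attached S (Function.update α e false) (Function.update β e true) y v := by
  have hβ : β e = false := by
    by_contra h
    exact hu.2 v hv (hj.openConn (by simpa using h))
  have hα : α e = false := by
    by_contra h
    have := hαβ e (by simpa using h)
    simp [hβ] at this
  have h1 : Function.update α e false = α := by rw [← hα, Function.update_eq_self]
  have h2 : Function.update (Function.update β e true) e false = β := by
    rw [Function.update_idem, ← hβ, Function.update_eq_self]
  rw [h1]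
  refine ⟨hv, e, u, by simp, hj, ?_, fun z hz => ?_⟩
  · rw [h2]; exact hy.symm
  · rw [h2]; exact fun h => hu.2 z hz (hy.trans h)

open scoped Classical in
/-- Opening an edge away from a detached cluster and touching an infinite `α`-cluster. -/
theorem Detached.update {α β : Γ × Fin d → Bool} (hαβ : ∀ e, α e = true → β e = true)
    {u v w : Γ} {e : Γ × Fin d} (hj : Joins S e v w) (hu : Detached S α β u)
    (hw : (Cluster S α w).Infinite) (huv : ¬ OpenConn S β u v) :
    Detached S (Function.update α e true) (Function.update β e true) u ∧
      (Cluster S (Function.update α e true) v).Infinite := by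
  have hKu : Cluster S (Function.update β e true) u = Cluster S β u :=
    cluster_update hj huv (hu.2 w hw) true
  refine ⟨⟨hKu ▸ hu.1, fun z hz h => ?_⟩, ?_⟩
  · have hz' : OpenConn S β u z := by
      have : z ∈ Cluster S (Function.update β e true) u := h
      rwa [hKu] at this
    have hsub := cluster_mono (S := S) hαβ z
    rw [cluster_update hj (fun h => huv (hz'.trans (hsub h)))
      (fun h => hu.2 w hw (hz'.trans (hsub h)))] at hz
    exact hu.2 z hz hz'
  · have hvw : OpenConn S (Function.update α e true) v w := hj.openConn (by simp)
    rw [hvw.cluster_eq]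
    refine hw.mono (cluster_mono (fun f hf => ?_) w)
    by_cases h : f = e
    · simp [h]
    · rwa [Function.update_of_ne h]

variable [Countable Γ]

/-- Häggström–Peres: if there is percolation at level `q`, then almost surely every infinite
cluster at a level `t > q` meets an infinite cluster at level `q`. -/
theorem IsProductLeb.ae_not_detached (hP : IsProductLeb P)
    (hgen : Subgroup.closure (Set.range S) = ⊤) {q t : ℝ} (hq : 0 < q) (hqt : q < t) (ht : t ≤ 1)
    (hperc : ∀ᵐ x ∂P, level q x ∈ PercEvent S) :
    ∀ᵐ x ∂P, ∀ u, ¬ Detached S (level q x) (level t x) u := by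
  classical
  have hfin := hP.ae_finite_receive
    (fun y b => {x | Attached S (level q x) (level t x) y b})
    (fun y b => measurableSet_attached S q t y b)
    (fun g y b x => attached_shift (α := level q x) (β := level t x) g)
    (fun x y b b' h h' => Attached.unique h h')
  have hle : ∀ (x : Γ × Fin d → ℝ) e, level q x e = true → level t x e = true :=
    fun x => level_mono hqt.le x
  have adj : ∀ u v e, Joins S e u v →
      P {x | Detached S (level q x) (level t x) u ∧ (Cluster S (level q x) v).Infinite} = 0 := by
    intro u v e hj
    refine hP.null_of_update e (unif_Ioc_ne_zero hq.le ht hqt) hfin ?_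
    rintro x ⟨hu, hv⟩ r hr hcon
    refine (hu.1.mono fun y hy => ?_) (hcon v)
    have := hu.attached_update (hle x) hj hv hy
    simp only [mem_ofPred_eq, level_update, hr.1.not_ge, hr.2, decide_false, decide_true]
    convert this
  have all : ∀ u w,
      P {x | Detached S (level q x) (level t x) u ∧ (Cluster S (level q x) w).Infinite} = 0 := by
    intro u w
    have hG : OpenConn S (fun _ => true) u w := openConn_top hgen u w fun _ => rfl
    induction hG with
    | refl =>
      convert measure_empty (μ := P)
      ext x
      simp only [mem_ofPred_eq, mem_empty_iff_false, iff_false]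
      exact fun h => h.1.2 u h.2 (OpenConn.refl S _ u)
    | @tail v w _ hstep ih =>
      obtain ⟨e, -, hj⟩ := hstep
      have h2 : P {x | (Detached S (level q x) (level t x) u ∧
          (Cluster S (level q x) w).Infinite) ∧ ¬ OpenConn S (level t x) u v} = 0 := by
        refine hP.null_of_update e (unif_Ioc_ne_zero le_rfl (hqt.le.trans ht) hq) ih ?_
        rintro x ⟨⟨hu, hw⟩, huv⟩ r hr
        have := hu.update (hle x) hj hw huv
        simp only [mem_ofPred_eq, level_update, hr.2, hr.2.trans hqt.le, decide_true]
        convert this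
      refine measure_mono_null (fun x hx => ?_) (measure_union_null (adj v w e hj) h2)
      by_cases huv : OpenConn S (level t x) u v
      · exact Or.inl ⟨hx.1.congr huv, hx.2⟩
      · exact Or.inr ⟨hx, huv⟩
  have all' : ∀ᵐ x ∂P, ∀ u w,
      ¬ (Detached S (level q x) (level t x) u ∧ (Cluster S (level q x) w).Infinite) := by
    rw [ae_all_iff]; intro u
    rw [ae_all_iff]; intro w
    rw [ae_iff]
    simpa only [not_not] using all u w
  filter_upwards [all', hperc] with x h ⟨w, hw⟩ u hu
  exact h u w ⟨hu, hw⟩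

/-- There is no percolation at level `0`. -/
theorem IsProductLeb.pos_of_perc (hP : IsProductLeb P) {q : ℝ}
    (hperc : ∀ᵐ x ∂P, level q x ∈ PercEvent S) : 0 < q := by
  have := hP.1
  by_contra hq
  have h0 : ∀ᵐ x ∂P, ∀ e, ¬ x e ≤ q := by
    rw [ae_all_iff]; intro e
    rw [ae_iff]
    have h1 := hP.2 {e} (fun _ => Iic q) (fun _ => measurableSet_Iic)
    simp only [Finset.mem_singleton, forall_eq, mem_Iic, Finset.prod_singleton] at h1
    simp only [not_not]
    rw [h1]
    refine measure_mono_null (t := {0}) (fun y hy => ?_) (by simp)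
    exact le_antisymm (le_trans hy.1 (not_lt.1 hq)) hy.2.1
  obtain ⟨x, hx, v, hv⟩ := (h0.and hperc).exists
  refine hv ((finite_singleton v).subset fun u hu => ?_)
  induction hu with
  | refl => rfl
  | tail _ hstep _ =>
    obtain ⟨e, he, -⟩ := hstep
    exact absurd (level_eq_true.1 he) (hx e)

/-- Uniqueness monotonicity. -/
theorem IsProductLeb.ae_unique_of_lt (hP : IsProductLeb P)
    (hgen : Subgroup.closure (Set.range S) = ⊤) {q t : ℝ} (hqt : q < t) (ht : t ≤ 1)
    (hu : ∀ᵐ x ∂P, level q x ∈ UniqueEvent S) :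
    ∀ᵐ x ∂P, level t x ∈ UniqueEvent S := by
  have hperc : ∀ᵐ x ∂P, level q x ∈ PercEvent S := hu.mono fun x hx => (mem_uniqueEvent_iff.1 hx).1
  filter_upwards [hu, hP.ae_not_detached hgen (hP.pos_of_perc hperc) hqt ht hperc] with x hx hd
  have hle : ∀ e, level q x e = true → level t x e = true := level_mono hqt.le x
  obtain ⟨⟨v, hv⟩, huniq⟩ := mem_uniqueEvent_iff.1 hx
  refine mem_uniqueEvent_iff.2 ⟨⟨v, hv.mono (cluster_mono hle v)⟩, fun a b ha hb => ?_⟩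
  have key : ∀ a, (Cluster S (level t x) a).Infinite → OpenConn S (level t x) a v := by
    intro a ha
    have := hd a
    simp only [Detached, not_and, not_forall, not_not] at this
    obtain ⟨z, hz, haz⟩ := this ha
    exact haz.trans ((huniq z v hz hv).mono hle)
  exact (key a ha).trans (key b hb).symm

end Monotonicity

section Paths

variable {S : Fin d → Γ} {ω : Γ × Fin d → Bool}

theorem finite_neighbors (S : Fin d → Γ) (u : Γ) : {v | ∃ e, Joins S e u v}.Finite := by
  refine ((finite_range fun i => u * S i).union (finite_range fun i => u * (S i)⁻¹)).subset ?_
  rintro v ⟨⟨g, i⟩, ⟨rfl, rfl⟩ | ⟨rfl, h⟩⟩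
  · exact Or.inl ⟨i, rfl⟩
  · exact Or.inr ⟨i, by simp [h]⟩

/-- König's lemma: an infinite cluster contains a ray from each of its vertices. -/
theorem exists_ray {v : Γ} (hv : (Cluster S ω v).Infinite) :
    ∃ (f : ℕ → Γ) (g : ℕ → Γ × Fin d), f 0 = v ∧ Function.Injective f ∧
      ∀ n, ω (g n) = true ∧ Joins S (g n) (f n) (f (n + 1)) := by
  classical
  let R : Set Γ → Γ → Γ → Prop := fun F a b => b ∉ F ∧ ∃ e, ω e = true ∧ Joins S e a b
  let C : Set Γ → Γ → Set Γ := fun F u => {w | Relation.ReflTransGen (R F) u w}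
  have restart : ∀ F b w, w ∈ C F b → w ∈ C (insert b F) b := by
    intro F b w h
    induction h with
    | refl => exact Relation.ReflTransGen.refl
    | @tail c w _ hstep ih =>
      by_cases hwb : w = b
      · subst hwb; exact Relation.ReflTransGen.refl
      · exact Relation.ReflTransGen.tail ih ⟨by simp [hwb, hstep.1], hstep.2⟩
  have next : ∀ F u, (C F u).Infinite → ∃ b, R F u b ∧ (C (insert b F) b).Infinite := by
    intro F u hinf
    by_contra! hcon
    apply hinf
    have hfin : {b | R F u b}.Finite :=
      (finite_neighbors S u).subset fun b hb => ⟨hb.2.choose, hb.2.choose_spec.2⟩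
    refine ((finite_singleton u).union
      (hfin.biUnion fun b hb => hcon b hb)).subset fun w hw => ?_
    rcases Relation.ReflTransGen.cases_head hw with h | ⟨b, hb, hbw⟩
    · exact Or.inl h.symm
    · exact Or.inr (mem_iUnion₂.2 ⟨b, hb, restart F b w hbw⟩)
  let T := {s : Set Γ × Γ // s.2 ∈ s.1 ∧ (C s.1 s.2).Infinite}
  have hstart : (C {v} v).Infinite := by
    refine hv.mono fun w hw => ?_
    have : w ∈ C ∅ v := by
      induction hw with
      | refl => exact Relation.ReflTransGen.refl
      | tail _ hstep ih => exact ih.tail ⟨by simp, hstep⟩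
    simpa using restart ∅ v w this
  choose! nx hnx1 hnx2 using next
  let step : T → T := fun s =>
    ⟨(insert (nx s.1.1 s.1.2) s.1.1, nx s.1.1 s.1.2), mem_insert _ _, hnx2 _ _ s.2.2⟩
  let seq : ℕ → T := fun n => step^[n] ⟨({v}, v), rfl, hstart⟩
  have hseq : ∀ n, seq (n + 1) = step (seq n) := fun n => Function.iterate_succ_apply' _ _ _
  have hR : ∀ n, R (seq n).1.1 (seq n).1.2 (seq (n + 1)).1.2 := fun n => by
    rw [hseq]; exact hnx1 _ _ (seq n).2.2
  have hmono : Monotone fun n => (seq n).1.1 :=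
    monotone_nat_of_le_succ fun n => by rw [hseq]; exact subset_insert _ _
  choose g hg using fun n => (hR n).2
  refine ⟨fun n => (seq n).1.2, g, rfl, ?_, hg⟩
  have hlt : ∀ m n, m < n → (seq m).1.2 ≠ (seq n).1.2 := by
    intro m n hmn heq
    obtain ⟨n, rfl⟩ := Nat.exists_eq_succ_of_ne_zero (Nat.ne_zero_of_lt hmn)
    exact (hR n).1 (heq ▸ hmono (Nat.le_of_lt_succ hmn) (seq m).2.1)
  intro m n h
  by_contra hne
  rcases Nat.lt_or_gt_of_ne hne with h' | h'
  exacts [hlt m n h' h, hlt n m h' h.symm]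

/-- Connected vertices are joined by a self-avoiding open path. -/
theorem OpenConn.exists_path {u v : Γ} (h : OpenConn S ω u v) :
    ∃ (n : ℕ) (f : ℕ → Γ), f 0 = u ∧ f n = v ∧
      (∀ k < n, ∃ e, ω e = true ∧ Joins S e (f k) (f (k + 1))) ∧
      ∀ i j, i < j → j ≤ n → f i ≠ f j := by
  classical
  have hex : ∃ (n : ℕ) (f : ℕ → Γ), f 0 = u ∧ f n = v ∧
      ∀ k < n, ∃ e, ω e = true ∧ Joins S e (f k) (f (k + 1)) := by
    induction h with
    | refl => exact ⟨0, fun _ => u, rfl, rfl, by simp⟩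
    | @tail b c _ hstep ih =>
      obtain ⟨n, f, h0, hn, hk⟩ := ih
      refine ⟨n + 1, Function.update f (n + 1) c, ?_, by simp, ?_⟩
      · rw [Function.update_of_ne (by omega), h0]
      · intro k hkn
        rcases Nat.lt_succ_iff_lt_or_eq.1 hkn with hk' | rfl
        · rw [Function.update_of_ne (by omega), Function.update_of_ne (by omega)]
          exact hk k hk'
        · rw [Function.update_self, Function.update_of_ne (by omega), hn]
          exact hstep
  obtain ⟨f, h0, hn, hk⟩ := Nat.find_spec hex
  refine ⟨Nat.find hex, f, h0, hn, hk, fun i j hij hj heq => ?_⟩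
  refine Nat.find_min hex (m := Nat.find hex - (j - i)) (by omega)
    ⟨fun k => if k ≤ i then f k else f (k + (j - i)), by simp [h0], ?_, fun k hkn => ?_⟩
  · dsimp only
    by_cases hji : Nat.find hex - (j - i) ≤ i
    · have : j = Nat.find hex := by omega
      rw [if_pos hji, show Nat.find hex - (j - i) = i by omega, heq, ← hn]
      congr 1
    · rw [if_neg hji, Nat.sub_add_cancel (by omega), hn]
  · rcases lt_trichotomy k i with hki | rfl | hki
    · simp only [hki.le, Nat.succ_le_of_lt hki, if_true]
      exact hk k (by omega)
    · have h1 := hk j (by omega)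
      simp only [le_refl, if_true, if_false, Nat.not_succ_le_self]
      rw [heq, show k + 1 + (j - k) = j + 1 by omega]
      exact h1
    · simp only [not_le.2 hki, not_le.2 (Nat.lt_succ_of_lt hki), if_false]
      rw [show k + 1 + (j - i) = k + (j - i) + 1 by omega]
      exact hk _ (by omega)

end Paths

section Forests

open scoped Classical in
/-- The endpoints of `e` lie in distinct infinite clusters of `ω` with `e` removed. -/
def Separates (S : Fin d → Γ) (ω : Γ × Fin d → Bool) (e : Γ × Fin d) : Prop :=
  (Cluster S (Function.update ω e false) e.1).Infinite ∧
    (Cluster S (Function.update ω e false) (e.1 * S e.2)).Infinite ∧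
    ¬ OpenConn S (Function.update ω e false) e.1 (e.1 * S e.2)

variable {S : Fin d → Γ} {x : Γ × Fin d → ℝ} {e : Γ × Fin d}

open scoped Classical in
theorem update_level_eq_true {t : ℝ} {f : Γ × Fin d} :
    Function.update (level t x) e false f = true ↔ f ≠ e ∧ x f ≤ t := by
  by_cases h : f = e
  · simp [h]
  · simp [h, level]

theorem joins_self (S : Fin d → Γ) (e : Γ × Fin d) : Joins S e e.1 (e.1 * S e.2) :=
  Or.inl ⟨rfl, rfl⟩

open scoped Classical in
theorem mem_FMSF_iff :
    e ∈ FMSF S x ↔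
      ¬ OpenConn S (Function.update (level (x e) x) e false) e.1 (e.1 * S e.2) := by
  constructor
  · intro he hconn
    obtain ⟨n, f, h0, hn, hk, hinj⟩ := hconn.symm.exists_path
    choose g hg hgj using fun k : Fin n => hk k k.2
    have hgne : ∀ k, e ≠ g k := fun k => (update_level_eq_true.1 (hg k)).1.symm
    suffices hc : IsCycle S (n + 1) (Fin.cons e g) (Fin.cons e.1 (fun k : Fin (n + 1) => f k)) by
      obtain ⟨k, hk1, hk2⟩ := he _ _ _ hc ⟨0, rfl⟩
      revert hk1 hk2
      refine Fin.cases ?_ (fun k => ?_) k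
      · intro h; exact absurd rfl h
      · intro _ h
        exact absurd (update_level_eq_true.1 (hg k)).2 (not_le.2 h)
    refine ⟨Nat.succ_pos n, ?_, ?_, ?_, ?_⟩
    · rw [← Fin.succ_last, Fin.cons_succ, Fin.cons_zero, Fin.val_last, hn]
    · intro k
      refine Fin.cases ?_ (fun k => ?_) k
      · simpa [h0] using joins_self S e
      · simpa [← Fin.succ_castSucc] using hgj k
    · have key : ∀ k : Fin n, (Fin.cons e.1 (fun k : Fin (n + 1) => f k) :
          Fin (n + 2) → Γ) k.succ.castSucc = f k := fun k => by
        rw [← Fin.succ_castSucc, Fin.cons_succ, Fin.val_castSucc]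
      have key₀ : (Fin.cons e.1 (fun k : Fin (n + 1) => f k) :
          Fin (n + 2) → Γ) (Fin.castSucc 0) = f n := hn.symm
      intro i j
      refine Fin.cases ?_ (fun i => ?_) i <;> refine Fin.cases ?_ (fun j => ?_) j <;>
        intro h <;> dsimp only at h
      · rfl
      · rw [key₀, key] at h
        exact absurd h.symm (hinj j n j.2 le_rfl)
      · rw [key₀, key] at h
        exact absurd h (hinj i n i.2 le_rfl)
      · rw [key, key] at h
        by_contra hne
        rcases lt_or_gt_of_ne (fun h' => hne (congrArg Fin.succ h')) with h' | h'
        exacts [hinj i j h' j.2.le h, hinj j i h' i.2.le h.symm]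
    · rw [Fin.cons_injective_iff]
      refine ⟨by rintro ⟨k, hk⟩; exact hgne k hk.symm, fun i j hij => ?_⟩
      by_contra hne
      have key : ∀ i j : Fin n, i < j → g i ≠ g j := by
        intro i j hlt heq
        have hj := hgj j
        rw [← heq] at hj
        rcases (hgj i).eq_or_eq hj with ⟨h, -⟩ | ⟨h, -⟩
        · exact hinj i j hlt j.2.le h
        · exact hinj i (j + 1) (by have : i.1 < j.1 := hlt; omega) j.2 h
      rcases lt_or_gt_of_ne hne with h | h
      exacts [key i j h hij, key j i h hij.symm]
  · rintro hconn n ed vs ⟨-, hclose, hj, -, hinj⟩ ⟨k₀, rfl⟩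
    by_contra! hcon
    have hopen : ∀ k, k ≠ k₀ →
        Function.update (level (x (ed k₀)) x) (ed k₀) false (ed k) = true := fun k hk =>
      update_level_eq_true.2 ⟨hinj.ne hk, hcon k (hinj.ne hk)⟩
    have h1 : ∀ m (hm : m ≤ k₀.1), OpenConn S (Function.update (level (x (ed k₀)) x) (ed k₀) false)
        (vs 0) (vs ⟨m, by omega⟩) := by
      intro m
      induction m with
      | zero => exact fun _ => OpenConn.refl S _ _
      | succ m ih =>
        intro hm
        exact (ih (by omega)).trans ((hj ⟨m, by omega⟩).openConn
          (hopen _ (by rw [ne_eq, Fin.ext_iff]; simp; omega)))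
    have h2 : ∀ m (hm : k₀.1 + 1 + m ≤ n),
        OpenConn S (Function.update (level (x (ed k₀)) x) (ed k₀) false)
        (vs k₀.succ) (vs ⟨k₀.1 + 1 + m, by omega⟩) := by
      intro m
      induction m with
      | zero => exact fun _ => OpenConn.refl S _ _
      | succ m ih =>
        intro hm
        exact (ih (by omega)).trans ((hj ⟨k₀.1 + 1 + m, by omega⟩).openConn
          (hopen _ (by rw [ne_eq, Fin.ext_iff]; simp; omega)))
    have h3 := h2 (n - (k₀.1 + 1)) (by omega)
    have h4 : (⟨k₀.1 + 1 + (n - (k₀.1 + 1)), by omega⟩ : Fin (n + 1)) = Fin.last n := by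
      rw [Fin.ext_iff]; simp
    rw [h4, hclose] at h3
    have h5 : OpenConn S _ (vs k₀.succ) (vs k₀.castSucc) := h3.trans (h1 k₀.1 le_rfl)
    rcases (hj k₀).eq_or_eq (joins_self S (ed k₀)) with ⟨h, h'⟩ | ⟨h, h'⟩
    · rw [h, h'] at h5; exact hconn h5.symm
    · rw [h, h'] at h5; exact hconn h5

open scoped Classical in
theorem infinite_of_biInfPath {ed : ℤ → Γ × Fin d} {vs : ℤ → Γ} (hp : IsBiInfPath S ed vs)
    {k₀ : ℤ} (hx : ∀ k, ed k ≠ ed k₀ → x (ed k) ≤ x (ed k₀)) :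
    (Cluster S (Function.update (level (x (ed k₀)) x) (ed k₀) false) (vs k₀)).Infinite ∧
    (Cluster S (Function.update (level (x (ed k₀)) x) (ed k₀) false) (vs (k₀ + 1))).Infinite := by
  obtain ⟨hinj, hj⟩ := hp
  have hne : ∀ k, k ≠ k₀ → ed k ≠ ed k₀ := by
    intro k hk heq
    have h := hj k
    rw [heq] at h
    rcases h.eq_or_eq (hj k₀) with ⟨h, -⟩ | ⟨h, h'⟩
    · exact hk (hinj h)
    · have := hinj h; have := hinj h'; omega
  have hopen : ∀ k, k ≠ k₀ →
      Function.update (level (x (ed k₀)) x) (ed k₀) false (ed k) = true := fun k hk =>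
    update_level_eq_true.2 ⟨hne k hk, hx k (hne k hk)⟩
  constructor
  · refine infinite_of_injective_forall_mem (f := fun n : ℕ => vs (k₀ - n))
      (fun m n h => by have := hinj h; omega) fun n => ?_
    induction n with
    | zero => simp only [Nat.cast_zero, sub_zero]; exact mem_cluster_self S _ _
    | succ n ih =>
      have h := hj (k₀ - (n + 1 : ℕ))
      rw [show k₀ - ((n + 1 : ℕ) : ℤ) + 1 = k₀ - n by push_cast; ring] at h
      exact OpenConn.trans ih (h.symm.openConn (hopen _ (by omega)))
  · refine infinite_of_injective_forall_mem (f := fun n : ℕ => vs (k₀ + 1 + n))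
      (fun m n h => by have := hinj h; omega) fun n => ?_
    induction n with
    | zero => simp only [Nat.cast_zero, add_zero]; exact mem_cluster_self S _ _
    | succ n ih =>
      have h := hj (k₀ + 1 + n)
      rw [show k₀ + 1 + (n : ℤ) + 1 = k₀ + 1 + (n + 1 : ℕ) by push_cast; ring] at h
      exact OpenConn.trans ih (h.openConn (hopen _ (by omega)))

open scoped Classical in
theorem exists_biInfPath {t : ℝ} (h : Separates S (level t x) e) :
    ∃ (ed : ℤ → Γ × Fin d) (vs : ℤ → Γ), IsBiInfPath S ed vs ∧ (∃ k, ed k = e) ∧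
      ∀ k, ed k ≠ e → x (ed k) ≤ t := by
  obtain ⟨ha, hb, hab⟩ := h
  obtain ⟨f, f', hf0, hfinj, hf⟩ := exists_ray ha
  obtain ⟨g, g', hg0, hginj, hg⟩ := exists_ray hb
  have hfc : ∀ n, OpenConn S (Function.update (level t x) e false) e.1 (f n) := by
    intro n
    induction n with
    | zero => rw [hf0]; exact OpenConn.refl S _ _
    | succ n ih => exact ih.trans ((hf n).2.openConn (hf n).1)
  have hgc : ∀ n, OpenConn S (Function.update (level t x) e false) (e.1 * S e.2) (g n) := by
    intro n
    induction n with
    | zero => rw [hg0]; exact OpenConn.refl S _ _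
    | succ n ih => exact ih.trans ((hg n).2.openConn (hg n).1)
  have hfg : ∀ m n, f m ≠ g n := fun m n h => hab ((hfc m).trans (h ▸ (hgc n).symm))
  refine ⟨fun k => match k with
    | Int.ofNat n => g' n
    | Int.negSucc 0 => e
    | Int.negSucc (n + 1) => f' n, fun k => match k with
    | Int.ofNat n => g n
    | Int.negSucc n => f n, ⟨?_, ?_⟩, ⟨-1, rfl⟩, ?_⟩
  · rintro (m | m) (n | n) h
    · rw [hginj h]
    · exact absurd h.symm (hfg n m)
    · exact absurd h (hfg m n)
    · rw [hfinj h]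
  · rintro (n | n | n)
    · exact (hg n).2
    · have h : Joins S e (f 0) (g 0) := by rw [hf0, hg0]; exact joins_self S e
      exact h
    · exact (hf n).2.symm
  · rintro (n | n | n) hne
    · exact (update_level_eq_true.1 (hg n).1).2
    · exact absurd rfl hne
    · exact (update_level_eq_true.1 (hf n).1).2

theorem mem_FMSF_and_notMem_WMSF_iff :
    e ∈ FMSF S x ∧ e ∉ WMSF S x ↔ Separates S (level (x e) x) e := by
  classical
  constructor
  · rintro ⟨hF, hW⟩
    have hW' : ¬ ∀ (ed : ℤ → Γ × Fin d) (vs : ℤ → Γ),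
        IsBiInfPath S ed vs → (∃ k, ed k = e) → ∃ k, ed k ≠ e ∧ x e < x (ed k) :=
      fun h => hW ⟨hF, h⟩
    push Not at hW'
    obtain ⟨ed, vs, hp, ⟨k₀, rfl⟩, hx⟩ := hW'
    obtain ⟨h1, h2⟩ := infinite_of_biInfPath hp hx
    have h3 := mem_FMSF_iff.1 hF
    rcases (hp.2 k₀).eq_or_eq (joins_self S (ed k₀)) with ⟨h, h'⟩ | ⟨h, h'⟩
    · rw [h] at h1; rw [h'] at h2
      exact ⟨h1, h2, h3⟩
    · rw [h] at h1; rw [h'] at h2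
      exact ⟨h2, h1, h3⟩
  · intro h
    refine ⟨mem_FMSF_iff.2 h.2.2, fun hW => ?_⟩
    obtain ⟨ed, vs, hp, he, hx⟩ := exists_biInfPath h
    obtain ⟨k, hk, hlt⟩ := hW.2 ed vs hp he
    exact absurd (hx k hk) (not_le.2 hlt)

end Forests

section Thresholds

variable {S : Fin d → Γ} {P : Measure (Γ × Fin d → ℝ)}

theorem IsProductLeb.null_of_not_separates (hP : IsProductLeb P)
    (hgen : Subgroup.closure (Set.range S) = ⊤) {p : ℝ} (hp : 0 < p) (hp1 : p ≤ 1)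
    (h : ∀ e, P {x | Separates S (level p x) e} = 0) (u w : Γ) :
    P {x | (Cluster S (level p x) u).Infinite ∧ (Cluster S (level p x) w).Infinite ∧
      ¬ OpenConn S (level p x) u w} = 0 := by
  classical
  have hconn := openConn_top hgen u w (ω := fun _ => true) fun _ => rfl
  induction hconn with
  | refl =>
    refine measure_mono_null (fun x hx => ?_) measure_empty
    exact hx.2.2 (OpenConn.refl S _ u)
  | @tail v w _ hstep ih =>
    obtain ⟨e, -, hj⟩ := hstep
    have h1 : P {x | (Cluster S (level p x) u).Infinite ∧ (Cluster S (level p x) w).Infinite ∧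
        ¬ OpenConn S (level p x) u w ∧ ¬ OpenConn S (level p x) u v} = 0 := by
      refine hP.null_of_update e (unif_Ioc_ne_zero le_rfl hp1 hp) ih ?_
      rintro x ⟨hu, hw, huw, huv⟩ r hr
      have hcl := cluster_update (S := S) (ω := level p x) hj huv huw true
      have hup : level p (Function.update x e r) = Function.update (level p x) e true := by
        rw [level_update, decide_eq_true hr.2]
      have hmono : ∀ f, level p x f = true → Function.update (level p x) e true f = true := by
        intro f hf
        by_cases hfe : f = e
        · simp [hfe]
        · simpa [hfe] using hf
      have hvw : OpenConn S (Function.update (level p x) e true) v w := hj.openConn (by simp)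
      refine ⟨?_, ?_, ?_⟩
      · rw [hup, hcl]; exact hu
      · rw [hup, hvw.cluster_eq]; exact hw.mono (cluster_mono hmono w)
      · rw [hup]
        intro hc
        have hc' : v ∈ Cluster S (Function.update (level p x) e true) u := hc
        rw [hcl] at hc'
        exact huv hc'
    refine measure_mono_null (fun x hx => ?_) (measure_union_null h1 (h e))
    obtain ⟨hu, hw, huw⟩ := hx
    by_cases huv : OpenConn S (level p x) u v
    · right
      have he : Function.update (level p x) e false = level p x := by
        rw [Function.update_eq_self_iff]
        by_contra he
        exact huw (huv.trans (hj.openConn (by simpa using Ne.symm he)))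
      have hv : (Cluster S (level p x) v).Infinite := huv.cluster_eq ▸ hu
      have hvw : ¬ OpenConn S (level p x) v w := fun h => huw (huv.trans h)
      change Separates S (level p x) e
      unfold Separates
      have he' : ∀ inst : DecidableEq (Γ × Fin d),
          @Function.update _ _ inst (level p x) e false = level p x := fun inst => by
        rw [← he]; congr!
      rw [he']
      rcases hj.eq_or_eq (joins_self S e) with ⟨rfl, rfl⟩ | ⟨rfl, rfl⟩
      · exact ⟨hv, hw, hvw⟩
      · exact ⟨hw, hv, fun h => hvw h.symm⟩
    · exact Or.inl ⟨hu, hw, huw, huv⟩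

open scoped Classical in
theorem separates_level_update {t r : ℝ} {x : Γ × Fin d → ℝ} {e : Γ × Fin d} :
    Separates S (level t (Function.update x e r)) e ↔ Separates S (level t x) e := by
  unfold Separates
  rw [level_update, Function.update_idem]

open scoped Classical in
theorem measurableSet_separates [Countable Γ] (S : Fin d → Γ) (e : Γ × Fin d) :
    MeasurableSet {ω | Separates S ω e} := by
  have hm : Measurable fun ω : Γ × Fin d → Bool => Function.update ω e false :=
    measurable_update_left
  exact (hm (measurableSet_cluster_infinite S _)).inter
    ((hm (measurableSet_cluster_infinite S _)).inter (hm (measurableSet_openConn S _ _)).compl)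

theorem IsProductLeb.null_iff_ae_separates_null [Countable Γ] (hP : IsProductLeb P)
    (e : Γ × Fin d) : P {x | e ∈ FMSF S x ∧ e ∉ WMSF S x} = 0 ↔
      ∀ᵐ t ∂unif, P {x | Separates S (level t x) e} = 0 := by
  classical
  have := hP.1
  have hA : MeasurableSet {q : ℝ × (Γ × Fin d → ℝ) | Separates S (level q.1 q.2) e} :=
    measurable_level_pair _ (measurableSet_separates S e)
  have hm : Measurable fun x : Γ × Fin d → ℝ => (x e, x) :=
    (measurable_pi_apply e).prodMk measurable_id
  have hset : {x | e ∈ FMSF S x ∧ e ∉ WMSF S x} =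
      (fun x : Γ × Fin d → ℝ => (x e, x)) ⁻¹' {q | Separates S (level q.1 q.2) e} := by
    ext x
    exact mem_FMSF_and_notMem_WMSF_iff
  rw [hset, ← (hP.measurePreserving_update e).measure_preimage (hm hA).nullMeasurableSet]
  have hpre : (fun q : ℝ × (Γ × Fin d → ℝ) => Function.update q.2 e q.1) ⁻¹'
      ((fun x : Γ × Fin d → ℝ => (x e, x)) ⁻¹' {q | Separates S (level q.1 q.2) e}) =
      {q | Separates S (level q.1 q.2) e} := by
    ext q
    change Separates S (level (Function.update q.2 e q.1 e) (Function.update q.2 e q.1)) e ↔ _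
    rw [Function.update_self, separates_level_update]
    rfl
  rw [hpre, Measure.measure_prod_null hA]
  rfl

theorem percEvent_mono {ω ω' : Γ × Fin d → Bool} (h : ∀ e, ω e = true → ω' e = true)
    (hω : ω ∈ PercEvent S) : ω' ∈ PercEvent S :=
  let ⟨v, hv⟩ := hω
  ⟨v, hv.mono (cluster_mono h v)⟩

open scoped Classical in
theorem percEvent_of_update {ω : Γ × Fin d → Bool} {e : Γ × Fin d} {b : Bool}
    (h : Function.update ω e b ∈ PercEvent S) : ω ∈ PercEvent S := by
  obtain ⟨v, hv⟩ := h
  have hsub : Cluster S (Function.update ω e b) v ⊆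
      Cluster S ω v ∪ (Cluster S ω e.1 ∪ Cluster S ω (e.1 * S e.2)) := by
    intro z hz
    change Relation.ReflTransGen _ v z at hz
    induction hz with
    | refl => exact Or.inl (mem_cluster_self S ω v)
    | @tail y z _ hstep ih =>
      obtain ⟨f, hf, hj⟩ := hstep
      by_cases hfe : f = e
      · subst hfe
        rcases hj.eq_or_eq (joins_self S f) with ⟨-, rfl⟩ | ⟨-, rfl⟩
        · exact Or.inr (Or.inr (mem_cluster_self S ω _))
        · exact Or.inr (Or.inl (mem_cluster_self S ω _))
      · rw [Function.update_of_ne hfe] at hf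
        have hyz := hj.openConn hf
        exact ih.imp (fun h => OpenConn.trans h hyz)
          (Or.imp (fun h => OpenConn.trans h hyz) (fun h => OpenConn.trans h hyz))
  by_contra hcon
  have hfin : ∀ u, (Cluster S ω u).Finite := fun u => not_infinite.1 fun h => hcon ⟨u, h⟩
  exact hv (((hfin _).union ((hfin _).union (hfin _))).subset hsub)

theorem IsProductLeb.ae_perc_of_ne_zero [Countable Γ] (hP : IsProductLeb P) {t : ℝ}
    (h : P {x | level t x ∈ PercEvent S} ≠ 0) : ∀ᵐ x ∂P, level t x ∈ PercEvent S := by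
  classical
  have := hP.1
  have hm : MeasurableSet {x : Γ × Fin d → ℝ | level t x ∈ PercEvent S} :=
    measurable_level t (measurableSet_percEvent S)
  have h1 := hP.zero_one hm (fun x e r => ?_) h
  · exact (prob_compl_eq_zero_iff hm).2 h1
  · change level t (Function.update x e r) ∈ PercEvent S ↔ level t x ∈ PercEvent S
    rw [level_update]
    refine ⟨percEvent_of_update, fun hx => ?_⟩
    refine percEvent_of_update (e := e) (b := level t x e) ?_
    rwa [Function.update_idem, Function.update_eq_self]

theorem IsProductLeb.separates_null_of_ae_unique (hP : IsProductLeb P) {t : ℝ} (ht0 : 0 ≤ t)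
    (ht1 : t < 1) (hu : ∀ᵐ x ∂P, level t x ∈ UniqueEvent S) (e : Γ × Fin d) :
    P {x | Separates S (level t x) e} = 0 := by
  classical
  refine hP.null_of_update e (unif_Ioc_ne_zero ht0 le_rfl ht1) hu fun x hx r hr => ?_
  change ¬ level t (Function.update x e r) ∈ UniqueEvent S
  rw [level_update, decide_eq_false (not_le.2 hr.1), mem_uniqueEvent_iff]
  obtain ⟨h1, h2, h3⟩ : Separates S (level t x) e := hx
  intro h
  apply h3
  convert h.2 e.1 (e.1 * S e.2) ?_ ?_
  · convert h1
  · convert h2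

theorem IsProductLeb.ae_level_one (hP : IsProductLeb P) [Countable Γ] [Infinite Γ]
    (hgen : Subgroup.closure (Set.range S) = ⊤) :
    ∀ᵐ x ∂P, level 1 x ∈ UniqueEvent S := by
  have := hP.1
  have h0 : ∀ᵐ x ∂P, ∀ e, x e ≤ 1 := by
    rw [ae_all_iff]
    intro e
    have h := hP.2 {e} (fun _ => Iic 1) fun _ => measurableSet_Iic
    have hI : Iic (1:ℝ) ∩ Icc 0 1 = Icc 0 1 := inter_eq_right.2 fun y hy => hy.2
    simp only [Finset.mem_singleton, forall_eq, mem_Iic, Finset.prod_singleton, hI,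
      Real.volume_Icc, sub_zero, ENNReal.ofReal_one] at h
    exact (prob_compl_eq_zero_iff (measurableSet_le (measurable_pi_apply e) measurable_const)).2 h
  filter_upwards [h0] with x hx
  have hc : ∀ u v, OpenConn S (level 1 x) u v := fun u v =>
    openConn_top hgen u v fun e => level_eq_true.2 (hx e)
  refine mem_uniqueEvent_iff.2 ⟨⟨1, ?_⟩, fun u v _ _ => hc u v⟩
  rw [show Cluster S (level 1 x) 1 = univ from eq_univ_of_forall fun v => hc 1 v]
  exact infinite_univ

theorem IsProductLeb.pc_eq [Countable Γ] (hP : IsProductLeb P) :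
    pc S = sInf {p | p ∈ Icc (0:ℝ) 1 ∧ ∀ᵐ x ∂P, level p x ∈ PercEvent S} := by
  unfold pc
  congr 1
  ext p
  exact and_congr_right fun hp => forall_isBernoulli_iff hP hp (measurableSet_percEvent S)

theorem IsProductLeb.pu_eq [Countable Γ] (hP : IsProductLeb P) :
    pu S = sInf {p | p ∈ Icc (0:ℝ) 1 ∧ ∀ᵐ x ∂P, level p x ∈ UniqueEvent S} := by
  unfold pu
  congr 1
  ext p
  exact and_congr_right fun hp => forall_isBernoulli_iff hP hp (measurableSet_uniqueEvent S)

theorem IsProductLeb.pu_le [Countable Γ] (hP : IsProductLeb P) {t : ℝ} (ht : t ∈ Icc (0:ℝ) 1)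
    (h : ∀ᵐ x ∂P, level t x ∈ UniqueEvent S) : pu S ≤ t := by
  rw [hP.pu_eq]
  exact csInf_le ⟨0, fun p hp => hp.1.1⟩ ⟨ht, h⟩

theorem IsProductLeb.pc_le [Countable Γ] (hP : IsProductLeb P) {t : ℝ} (ht : t ∈ Icc (0:ℝ) 1)
    (h : ∀ᵐ x ∂P, level t x ∈ PercEvent S) : pc S ≤ t := by
  rw [hP.pc_eq]
  exact csInf_le ⟨0, fun p hp => hp.1.1⟩ ⟨ht, h⟩

variable [Countable Γ] [Infinite Γ]

theorem IsProductLeb.ae_perc_of_pc_lt (hP : IsProductLeb P)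
    (hgen : Subgroup.closure (Set.range S) = ⊤) {t : ℝ} (ht : pc S < t) :
    ∀ᵐ x ∂P, level t x ∈ PercEvent S := by
  rw [hP.pc_eq] at ht
  have hne : {p | p ∈ Icc (0:ℝ) 1 ∧ ∀ᵐ x ∂P, level p x ∈ PercEvent S}.Nonempty :=
    ⟨1, right_mem_Icc.2 zero_le_one, (hP.ae_level_one hgen).mono fun x hx =>
      (mem_uniqueEvent_iff.1 hx).1⟩
  obtain ⟨p, ⟨-, hp⟩, hpt⟩ := exists_lt_of_csInf_lt hne ht
  exact hp.mono fun x hx => percEvent_mono (level_mono hpt.le x) hx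

theorem IsProductLeb.ae_unique_of_pu_lt (hP : IsProductLeb P)
    (hgen : Subgroup.closure (Set.range S) = ⊤) {t : ℝ} (ht : pu S < t) (ht1 : t ≤ 1) :
    ∀ᵐ x ∂P, level t x ∈ UniqueEvent S := by
  rw [hP.pu_eq] at ht
  have hne : {p | p ∈ Icc (0:ℝ) 1 ∧ ∀ᵐ x ∂P, level p x ∈ UniqueEvent S}.Nonempty :=
    ⟨1, right_mem_Icc.2 zero_le_one, hP.ae_level_one hgen⟩
  obtain ⟨p, ⟨-, hp⟩, hpt⟩ := exists_lt_of_csInf_lt hne ht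
  exact hP.ae_unique_of_lt hgen hpt ht1 hp

/-- Off a null set of levels, no edge separates two infinite clusters when `p_u ≤ p_c`. -/
theorem IsProductLeb.ae_separates_null_of_pu_le_pc (hP : IsProductLeb P)
    (hgen : Subgroup.closure (Set.range S) = ⊤) (h : pu S ≤ pc S) (e : Γ × Fin d) :
    ∀ᵐ t ∂unif, P {x | Separates S (level t x) e} = 0 := by
  classical
  have hne : ∀ a : ℝ, ∀ᵐ t ∂unif, t ≠ a := fun a =>
    ae_restrict_of_ae (by simp [ae_iff])
  filter_upwards [ae_restrict_mem measurableSet_Icc, hne (pc S), hne 1] with t ht htc ht1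
  rcases lt_or_gt_of_ne htc with hlt | hlt
  · by_contra h0
    refine absurd (hP.pc_le ht (hP.ae_perc_of_ne_zero fun h1 => h0 ?_)) (not_le.2 hlt)
    exact measure_mono_null (fun x hx => percEvent_of_update (e := e) (b := false)
      ⟨e.1, hx.1⟩) h1
  · exact hP.separates_null_of_ae_unique ht.1 (lt_of_le_of_ne ht.2 ht1)
      (hP.ae_unique_of_pu_lt hgen (h.trans_lt hlt) ht.2) e

theorem IsProductLeb.pu_le_pc_of_ae_separates_null (hP : IsProductLeb P)
    (hgen : Subgroup.closure (Set.range S) = ⊤)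
    (h : ∀ e, ∀ᵐ t ∂unif, P {x | Separates S (level t x) e} = 0) : pu S ≤ pc S := by
  by_contra! hlt
  have hpu : pu S ≤ 1 := hP.pu_le (right_mem_Icc.2 zero_le_one) (hP.ae_level_one hgen)
  have hpc : 0 ≤ pc S := Real.sInf_nonneg fun p hp => hp.1.1
  obtain ⟨m, hm, hmu⟩ := exists_between hlt
  have hI := unif_Ioc_ne_zero hpc (hmu.le.trans hpu) hm
  have hf : ∃ᵐ t ∂unif, t ∈ Ioc (pc S) m := by
    rw [frequently_ae_iff]; exact hI
  obtain ⟨t, ⟨htc, htm⟩, hsep⟩ := (hf.and_eventually (ae_all_iff.2 h)).exists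
  have ht0 : 0 < t := hpc.trans_lt htc
  have ht1 : t ≤ 1 := htm.trans (hmu.le.trans hpu)
  have hconn : ∀ᵐ x ∂P, ∀ u w, ¬ ((Cluster S (level t x) u).Infinite ∧
      (Cluster S (level t x) w).Infinite ∧ ¬ OpenConn S (level t x) u w) := by
    simp only [ae_all_iff]
    intro u w
    have := hP.null_of_not_separates hgen ht0 ht1 hsep u w
    rw [ae_iff]
    simpa only [not_not] using this
  have hu : ∀ᵐ x ∂P, level t x ∈ UniqueEvent S := by
    filter_upwards [hconn, hP.ae_perc_of_pc_lt hgen htc] with x hx hp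
    refine mem_uniqueEvent_iff.2 ⟨hp, fun u w h1 h2 => ?_⟩
    by_contra h3
    exact hx u w ⟨h1, h2, h3⟩
  exact absurd (hP.pu_le ⟨ht0.le, ht1⟩ hu) (not_le.2 (htm.trans_lt hmu))

end Thresholds

/-- Lyons–Peres–Schramm: on a Cayley graph of an infinite finitely generated group,
`WMSF ≠ FMSF` (an edge lies in the free but not the wired minimal spanning forest with
positive probability) if and only if `p_c < p_u`. -/
theorem wmsf_ne_fmsf_iff_pc_lt_pu (Γ : Type) [Group Γ] [Infinite Γ] (d : ℕ)
    (S : Fin d → Γ) (hgen : Subgroup.closure (Set.range S) = ⊤)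
    (P : Measure ((Γ × Fin d) → ℝ)) (hP : IsProductLeb P) :
    (∃ e : Γ × Fin d, 0 < P {x | e ∈ FMSF S x ∧ e ∉ WMSF S x}) ↔ pc S < pu S := by
  have := countable_of_closure_eq_top hgen
  rw [← not_iff_not, not_lt]
  push Not
  simp only [nonpos_iff_eq_zero, hP.null_iff_ae_separates_null]
  exact ⟨hP.pu_le_pc_of_ae_separates_null hgen, hP.ae_separates_null_of_pu_le_pc hgen⟩

end
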